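/- arXiv:1206.5630 — 3 statements merged into one kernel-verified Lean document; each statement's English description precedes it below -/
import Mathlib

section
/- Let n ≥ 1 and let a be a separable density operator in M_n ⊗ M_n. Then S(a) and T(a) are real numbers satisfying 0 ≤ S(a) ≤ 1 and 0 ≤ T(a) ≤ 1. -/
open Matrix
open scoped Kronecker ComplexOrder

/-- A matrix in `M_n ⊗ M_n` is separable if it is a finite sum `∑ k, b k ⊗ₖ c k`
with all `b k`, `c k` positive semidefinite. -/
def IsSeparableMatrix {n : ℕ} (a : Matrix (Fin n × Fin n) (Fin n × Fin n) ℂ) : Prop :=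
  ∃ (N : ℕ) (b c : Fin N → Matrix (Fin n) (Fin n) ℂ),
    (∀ k, (b k).PosSemidef) ∧ (∀ k, (c k).PosSemidef) ∧ a = ∑ k, b k ⊗ₖ c k

/-- `S(a) = ∑_{ij} a_{(ij)(ij)}`. -/
noncomputable def Smap {n : ℕ} (a : Matrix (Fin n × Fin n) (Fin n × Fin n) ℂ) : ℂ :=
  ∑ i : Fin n, ∑ j : Fin n, a (i, i) (j, j)

/-- `T(a) = ∑_{ij} a_{(ij)(ji)}`. -/
noncomputable def Tmap {n : ℕ} (a : Matrix (Fin n × Fin n) (Fin n × Fin n) ℂ) : ℂ :=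
  ∑ i : Fin n, ∑ j : Fin n, a (i, j) (j, i)

section RankOne

variable {ι : Type*} [Fintype ι]

theorem Matrix.trace_vecMulVec_mul_vecMulVec_mem_Icc (v w : ι → ℂ) :
    (vecMulVec v (star v) * vecMulVec w (star w)).trace ∈
      Set.Icc 0 ((vecMulVec v (star v)).trace * (vecMulVec w (star w)).trace) := by
  have hconj : v ⬝ᵥ star w = star (star v ⬝ᵥ w) := by
    rw [← star_dotProduct_star, star_star, dotProduct_comm]
  have htr : (vecMulVec v (star v) * vecMulVec w (star w)).trace =
      ((‖star v ⬝ᵥ w‖ ^ 2 : ℝ) : ℂ) := by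
    rw [vecMulVec_mul_vecMulVec, trace_vecMulVec, dotProduct_smul, hconj, smul_eq_mul]
    simpa using Complex.mul_conj' (star v ⬝ᵥ w)
  have hnorm (u : ι → ℂ) : u ⬝ᵥ star u = ((‖WithLp.toLp 2 u‖ ^ 2 : ℝ) : ℂ) := by
    have := inner_self_eq_norm_sq_to_K (𝕜 := ℂ) (WithLp.toLp 2 u)
    rw [EuclideanSpace.inner_toLp_toLp] at this
    simpa using this
  have hle : ‖star v ⬝ᵥ w‖ ≤ ‖WithLp.toLp 2 v‖ * ‖WithLp.toLp 2 w‖ := by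
    have := norm_inner_le_norm (𝕜 := ℂ) (WithLp.toLp 2 v) (WithLp.toLp 2 w)
    rwa [EuclideanSpace.inner_toLp_toLp, dotProduct_comm] at this
  rw [htr, trace_vecMulVec, trace_vecMulVec, hnorm, hnorm, ← Complex.ofReal_mul, ← mul_pow]
  exact ⟨by exact_mod_cast sq_nonneg ‖star v ⬝ᵥ w‖,
    by exact_mod_cast pow_le_pow_left₀ (norm_nonneg _) hle 2⟩

theorem Matrix.PosSemidef.trace_mul_mem_Icc {A B : Matrix ι ι ℂ} (hA : A.PosSemidef)
    (hB : B.PosSemidef) : (A * B).trace ∈ Set.Icc 0 (A.trace * B.trace) := by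
  obtain ⟨m, v, rfl⟩ := posSemidef_iff_eq_sum_vecMulVec.mp hA
  obtain ⟨l, w, rfl⟩ := posSemidef_iff_eq_sum_vecMulVec.mp hB
  simp only [Finset.sum_mul_sum, trace_sum]
  exact ⟨Finset.sum_nonneg fun i _ => Finset.sum_nonneg fun j _ =>
      (trace_vecMulVec_mul_vecMulVec_mem_Icc _ _).1,
    Finset.sum_le_sum fun i _ => Finset.sum_le_sum fun j _ =>
      (trace_vecMulVec_mul_vecMulVec_mem_Icc _ _).2⟩

end RankOne

theorem Smap_sum_kronecker {n N : ℕ} (b c : Fin N → Matrix (Fin n) (Fin n) ℂ) :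
    Smap (∑ k, b k ⊗ₖ c k) = ∑ k, (b k * (c k)ᵀ).trace := by
  simp only [Smap, Matrix.sum_apply, kroneckerMap_apply, trace, diag, mul_apply, transpose_apply]
  rw [Finset.sum_comm]
  simp_rw [Finset.sum_comm (s := (Finset.univ : Finset (Fin N)))]
  rw [Finset.sum_comm]

theorem Tmap_sum_kronecker {n N : ℕ} (b c : Fin N → Matrix (Fin n) (Fin n) ℂ) :
    Tmap (∑ k, b k ⊗ₖ c k) = ∑ k, (b k * c k).trace := by
  simp only [Tmap, Matrix.sum_apply, kroneckerMap_apply, trace, diag, mul_apply]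
  rw [Finset.sum_comm]
  simp_rw [Finset.sum_comm (s := (Finset.univ : Finset (Fin N)))]
  rw [Finset.sum_comm]

theorem separable_density_S_T_le_one (n : ℕ) (hn : 1 ≤ n)
    (a : Matrix (Fin n × Fin n) (Fin n × Fin n) ℂ)
    (hsep : IsSeparableMatrix a) (hpsd : a.PosSemidef) (htr : a.trace = 1) :
    ∃ s t : ℝ, Smap a = (s : ℂ) ∧ Tmap a = (t : ℂ) ∧
      0 ≤ s ∧ s ≤ 1 ∧ 0 ≤ t ∧ t ≤ 1 := by
  obtain ⟨N, b, c, hb, hc, rfl⟩ := hsep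
  rw [trace_sum] at htr
  simp only [trace_kronecker] at htr
  have hS (k) := (hb k).trace_mul_mem_Icc (hc k).transpose
  have hT (k) := (hb k).trace_mul_mem_Icc (hc k)
  simp only [trace_transpose] at hS
  have hS0 : 0 ≤ Smap (∑ k, b k ⊗ₖ c k) := by
    rw [Smap_sum_kronecker]
    exact Finset.sum_nonneg fun k _ => (hS k).1
  have hS1 : Smap (∑ k, b k ⊗ₖ c k) ≤ 1 := by
    rw [Smap_sum_kronecker, ← htr]
    exact Finset.sum_le_sum fun k _ => (hS k).2
  have hT0 : 0 ≤ Tmap (∑ k, b k ⊗ₖ c k) := by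
    rw [Tmap_sum_kronecker]
    exact Finset.sum_nonneg fun k _ => (hT k).1
  have hT1 : Tmap (∑ k, b k ⊗ₖ c k) ≤ 1 := by
    rw [Tmap_sum_kronecker, ← htr]
    exact Finset.sum_le_sum fun k _ => (hT k).2
  exact ⟨_, _, Complex.eq_re_of_ofReal_le (r := 0) (by simpa using hS0),
    Complex.eq_re_of_ofReal_le (r := 0) (by simpa using hT0),
    (Complex.le_def.mp hS0).1, (Complex.le_def.mp hS1).1,
    (Complex.le_def.mp hT0).1, (Complex.le_def.mp hT1).1⟩
end

section
/- Let θ be real and let a be a real number. The 3×3 complex matrix P(a,θ) with rows (a, −e^{iθ}, −e^{−iθ}), (−e^{−iθ}, a, −e^{iθ}), (−e^{iθ}, −e^{−iθ}, a) is positive semidefinite if and only if a ≥ p_θ. -/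
open Matrix
open scoped ComplexOrder

/-- `p_θ = max(2cos(θ − 2π/3), 2cos θ, 2cos(θ + 2π/3))`. -/
noncomputable def pTheta (θ : ℝ) : ℝ :=
  max (max (2 * Real.cos (θ - 2 * Real.pi / 3)) (2 * Real.cos θ))
    (2 * Real.cos (θ + 2 * Real.pi / 3))

/-- The matrix `P(a, θ)`. -/
noncomputable def Pmat (a θ : ℝ) : Matrix (Fin 3) (Fin 3) ℂ :=
  !![(a : ℂ), -Complex.exp (θ * Complex.I), -Complex.exp (-θ * Complex.I);
     -Complex.exp (-θ * Complex.I), (a : ℂ), -Complex.exp (θ * Complex.I);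
     -Complex.exp (θ * Complex.I), -Complex.exp (-θ * Complex.I), (a : ℂ)]

open Complex in
theorem ofReal_two_mul_cos_add (θ φ : ℝ) :
    ((2 * Real.cos (θ + φ) : ℝ) : ℂ) = exp (θ * I) * exp (φ * I) + exp (-θ * I) * exp (-φ * I) := by
  push_cast
  rw [Complex.cos, ← exp_add, ← exp_add, ← add_mul, ← add_mul, neg_add]
  ring

/-- The `3 × 3` Fourier matrix attached to a cube root of unity `w`. -/
def fourierThree (w : ℂ) : Matrix (Fin 3) (Fin 3) ℂ :=
  !![1, 1, 1; 1, w, w ^ 2; 1, w ^ 2, w]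

theorem star_fourierThree {w : ℂ} (hw : w ^ 2 + w + 1 = 0) (hs : star w = w ^ 2) :
    star (fourierThree w) = fourierThree (w ^ 2) := by
  have h4 : w ^ 4 = w := by linear_combination (w ^ 2 - w) * hw
  rw [fourierThree, star_eq_conjTranspose]
  ext i j
  fin_cases i <;> fin_cases j <;> simp [fourierThree, ← pow_mul, h4, ← starRingEnd_apply] <;>
    simp [starRingEnd_apply, hs, ← pow_mul, h4]

theorem isUnit_fourierThree {w : ℂ} (hw : w ^ 2 + w + 1 = 0) : IsUnit (fourierThree w) := by
  rw [isUnit_iff_isUnit_det, isUnit_iff_ne_zero]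
  intro h
  have hdet : (fourierThree w).det = -3 * (2 * w + 1) := by
    simp only [fourierThree, det_fin_three, of_apply, cons_val]
    linear_combination (-w ^ 2 + w + 3) * hw
  have h9 : (-3 * (2 * w + 1)) ^ 2 = -27 := by linear_combination 36 * hw
  rw [← hdet, h] at h9
  norm_num at h9

theorem star_fourierThree_mul_Pmat_mul {w : ℂ} (hw : w ^ 2 + w + 1 = 0) (hs : star w = w ^ 2)
    (a θ : ℝ) :
    star (fourierThree w) * Pmat a θ * fourierThree w =
      diagonal ![
        3 * (a - (Complex.exp (θ * Complex.I) + Complex.exp (-θ * Complex.I))),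
        3 * (a - (Complex.exp (θ * Complex.I) * w + Complex.exp (-θ * Complex.I) * w ^ 2)),
        3 * (a - (Complex.exp (θ * Complex.I) * w ^ 2 + Complex.exp (-θ * Complex.I) * w))] := by
  rw [star_fourierThree hw hs, Pmat]
  generalize Complex.exp (θ * Complex.I) = z
  generalize Complex.exp (-θ * Complex.I) = y
  ext i j
  fin_cases i <;> fin_cases j <;>
    simp [fourierThree, mul_apply, Fin.sum_univ_three] <;> grind

theorem Pmat_posSemidef_iff (a θ : ℝ) :
    (Pmat a θ).PosSemidef ↔ pTheta θ ≤ a := by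
  set w : ℂ := Complex.exp ((2 * Real.pi / 3 : ℝ) * Complex.I) with hwdef
  have hw : w ^ 2 + w + 1 = 0 := by
    have h := (Complex.isPrimitiveRoot_exp 3 (by norm_num)).geom_sum_eq_zero (by norm_num)
    have he : Complex.exp (2 * Real.pi * Complex.I / (3 : ℕ)) = w := by
      rw [hwdef]
      congr 1
      push_cast
      ring
    rw [he] at h
    simp only [Finset.sum_range_succ, Finset.sum_range_zero] at h
    linear_combination h
  have hinv : Complex.exp (-(2 * Real.pi / 3 : ℝ) * Complex.I) = w ^ 2 := by
    rw [neg_mul, Complex.exp_neg, ← hwdef]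
    exact inv_eq_of_mul_eq_one_right (by linear_combination (w - 1) * hw)
  have hs : star w = w ^ 2 := by
    rw [← hinv, hwdef, ← starRingEnd_apply, ← Complex.exp_conj, map_mul, Complex.conj_ofReal,
      Complex.conj_I, mul_neg, neg_mul]
  have h0 := ofReal_two_mul_cos_add θ 0
  have h1 := ofReal_two_mul_cos_add θ (2 * Real.pi / 3)
  have h2 := ofReal_two_mul_cos_add θ (-(2 * Real.pi / 3))
  rw [hinv, ← hwdef] at h1
  rw [Complex.ofReal_neg, neg_neg, hinv, ← hwdef, ← sub_eq_add_neg] at h2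
  simp only [add_zero, Complex.ofReal_zero, neg_zero, zero_mul, Complex.exp_zero, mul_one] at h0
  have nonneg_iff (x : ℝ) : (0 : ℂ) ≤ 3 * (a - (x : ℂ)) ↔ x ≤ a := by
    rw [show (3 * (a - (x : ℂ))) = ((3 * (a - x) : ℝ) : ℂ) by push_cast; rfl,
      Complex.zero_le_real]
    constructor <;> intro h <;> linarith
  rw [← (isUnit_fourierThree hw).posSemidef_star_left_conjugate_iff,
    star_fourierThree_mul_Pmat_mul hw hs, ← h0, ← h1, ← h2, posSemidef_diagonal_iff]
  simp only [Fin.forall_fin_succ, pTheta, max_le_iff]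
  simp [-Complex.ofReal_mul, -Complex.ofReal_cos, nonneg_iff]
  tauto
end

section
/- Let a, b, c ≥ 0 be real numbers and −π ≤ θ ≤ π. The linear map φ(a,b,c,θ) : M_3 → M_3 is positive if and only if (i) a + b + c ≥ p_θ and (ii) a ≤ 1 implies b·c ≥ (1 − a)². -/
open Matrix
open scoped ComplexOrder

/-- The Ha–Kye map `φ(a,b,c,θ) : M₃ → M₃`. -/
noncomputable def phiHK (a b c θ : ℝ) (x : Matrix (Fin 3) (Fin 3) ℂ) :
    Matrix (Fin 3) (Fin 3) ℂ :=
  !![(a : ℂ) * x 0 0 + (b : ℂ) * x 1 1 + (c : ℂ) * x 2 2,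
       -Complex.exp (θ * Complex.I) * x 0 1,
       -Complex.exp (-θ * Complex.I) * x 0 2;
     -Complex.exp (-θ * Complex.I) * x 1 0,
       (c : ℂ) * x 0 0 + (a : ℂ) * x 1 1 + (b : ℂ) * x 2 2,
       -Complex.exp (θ * Complex.I) * x 1 2;
     -Complex.exp (θ * Complex.I) * x 2 0,
       -Complex.exp (-θ * Complex.I) * x 2 1,
       (b : ℂ) * x 0 0 + (c : ℂ) * x 1 1 + (a : ℂ) * x 2 2]

lemma hermitian_form_two_nonneg {p r : ℝ} {q : ℂ} (hp : 0 ≤ p) (hr : 0 ≤ r)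
    (hq : Complex.normSq q ≤ p * r) (u v : ℂ) :
    0 ≤ p * Complex.normSq u + r * Complex.normSq v + 2 * (star u * q * v).re := by
  have h1 : |(star u * q * v).re| ≤ ‖u‖ * ‖q‖ * ‖v‖ := by
    simpa using Complex.abs_re_le_norm (star u * q * v)
  rw [Complex.normSq_eq_norm_sq] at *
  rw [Complex.normSq_eq_norm_sq]
  have h2 : ‖q‖ ≤ √p * √r := by
    rw [← Real.sqrt_mul hp]
    exact Real.le_sqrt_of_sq_le hq
  have h3 : ‖u‖ * ‖q‖ * ‖v‖ ≤ ‖u‖ * (√p * √r) * ‖v‖ := by gcongr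
  have h4 := neg_abs_le (star u * q * v).re
  have h5 := Real.sq_sqrt hp
  have h6 := Real.sq_sqrt hr
  have h7 := sq_nonneg (√p * ‖u‖ - √r * ‖v‖)
  have h8 : (√p * ‖u‖ - √r * ‖v‖) ^ 2 =
      p * ‖u‖ ^ 2 + r * ‖v‖ ^ 2 - 2 * (‖u‖ * (√p * √r) * ‖v‖) := by
    rw [← h5, ← h6, Real.sqrt_sq (Real.sqrt_nonneg p), Real.sqrt_sq (Real.sqrt_nonneg r)]
    ring
  linarith

/-- The Hermitian form of a `3 × 3` Hermitian matrix is nonnegative when its principal minors of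
order two and three and its diagonal entries are nonnegative. -/
lemma hermitian_form_three_nonneg {d₁ d₂ d₃ : ℝ} {α β γ : ℂ}
    (h₁ : 0 ≤ d₁) (h₂ : 0 ≤ d₂) (h₃ : 0 ≤ d₃)
    (h₁₂ : Complex.normSq α ≤ d₁ * d₂) (h₂₃ : Complex.normSq β ≤ d₂ * d₃)
    (h₁₃ : Complex.normSq γ ≤ d₁ * d₃)
    (hdet : 0 ≤ d₁ * d₂ * d₃ - d₁ * Complex.normSq β - d₂ * Complex.normSq γ
      - d₃ * Complex.normSq α + 2 * (α * β * γ).re) (u v w : ℂ) :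
    0 ≤ d₁ * Complex.normSq u + d₂ * Complex.normSq v + d₃ * Complex.normSq w
      + 2 * (star u * α * v + star v * β * w + star w * γ * u).re := by
  rcases h₁.eq_or_lt with rfl | hpos
  · have hα : α = 0 := Complex.normSq_eq_zero.1 (le_antisymm (by simpa using h₁₂)
      (Complex.normSq_nonneg α))
    have hγ : γ = 0 := Complex.normSq_eq_zero.1 (le_antisymm (by simpa using h₁₃)
      (Complex.normSq_nonneg γ))
    subst hα hγ
    simpa using hermitian_form_two_nonneg h₂ h₃ h₂₃ v w
  · have key := hermitian_form_two_nonneg (p := d₁ * d₂ - Complex.normSq α)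
      (r := d₁ * d₃ - Complex.normSq γ) (q := d₁ * β - star α * star γ)
      (by linarith) (by linarith) (by
        have := mul_nonneg h₁ hdet
        simp only [Complex.normSq_apply, Complex.mul_re, Complex.mul_im, Complex.sub_re,
          Complex.sub_im, Complex.star_def, Complex.conj_re, Complex.conj_im, Complex.ofReal_re,
          Complex.ofReal_im] at this ⊢
        linarith) v w
    have hsq := Complex.normSq_nonneg (d₁ * u + α * v + star γ * w)
    refine nonneg_of_mul_nonneg_right (a := d₁) ?_ hpos
    simp only [Complex.normSq_apply, Complex.mul_re, Complex.mul_im, Complex.sub_re,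
      Complex.sub_im, Complex.add_re, Complex.add_im, Complex.star_def, Complex.conj_re,
      Complex.conj_im, Complex.ofReal_re, Complex.ofReal_im] at key hsq ⊢
    linarith

lemma posSemidef_fin_three {d₁ d₂ d₃ : ℝ} {α β γ : ℂ}
    (h₁ : 0 ≤ d₁) (h₂ : 0 ≤ d₂) (h₃ : 0 ≤ d₃)
    (h₁₂ : Complex.normSq α ≤ d₁ * d₂) (h₂₃ : Complex.normSq β ≤ d₂ * d₃)
    (h₁₃ : Complex.normSq γ ≤ d₁ * d₃)
    (hdet : 0 ≤ d₁ * d₂ * d₃ - d₁ * Complex.normSq β - d₂ * Complex.normSq γ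
      - d₃ * Complex.normSq α + 2 * (α * β * γ).re) :
    (!![(d₁ : ℂ), α, star γ; star α, (d₂ : ℂ), β; γ, star β, (d₃ : ℂ)]).PosSemidef := by
  refine PosSemidef.of_dotProduct_mulVec_nonneg ?_ fun x => ?_
  · ext i j
    fin_cases i <;> fin_cases j <;> simp [Matrix.conjTranspose_apply]
  · have := hermitian_form_three_nonneg h₁ h₂ h₃ h₁₂ h₂₃ h₁₃ hdet (x 0) (x 1) (x 2)
    rw [Complex.nonneg_iff]
    simp only [dotProduct, mulVec, Fin.sum_univ_three, Pi.star_apply, Matrix.of_apply,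
      Matrix.cons_val', Matrix.cons_val_zero, Matrix.cons_val_one, Matrix.cons_val,
      Complex.normSq_apply, Complex.mul_re, Complex.mul_im,
      Complex.add_re, Complex.add_im, Complex.star_def, Complex.conj_re,
      Complex.conj_im, Complex.ofReal_re, Complex.ofReal_im] at this ⊢
    constructor
    · linarith
    · ring

lemma cos_two_pi_div_three : Real.cos (2 * Real.pi / 3) = -1 / 2 := by
  rw [show 2 * Real.pi / 3 = Real.pi - Real.pi / 3 by ring, Real.cos_pi_sub, Real.cos_pi_div_three]
  norm_num

lemma sin_two_pi_div_three : Real.sin (2 * Real.pi / 3) = √3 / 2 := by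
  rw [show 2 * Real.pi / 3 = Real.pi - Real.pi / 3 by ring, Real.sin_pi_sub, Real.sin_pi_div_three]

lemma pTheta_le_iff (θ p : ℝ) : pTheta θ ≤ p ↔
    (-Real.cos θ + √3 * Real.sin θ ≤ p ∧ 2 * Real.cos θ ≤ p) ∧
      -Real.cos θ - √3 * Real.sin θ ≤ p := by
  unfold pTheta
  rw [max_le_iff, max_le_iff, Real.cos_sub, Real.cos_add, cos_two_pi_div_three,
    sin_two_pi_div_three]
  ring_nf

lemma two_mul_cos_three_mul_le {θ p : ℝ} (h : pTheta θ ≤ p) :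
    2 * Real.cos (3 * θ) ≤ p ^ 3 - 3 * p := by
  obtain ⟨⟨h1, h2⟩, h3⟩ := (pTheta_le_iff θ p).1 h
  have h4 := mul_nonneg (mul_nonneg (sub_nonneg.2 h1) (sub_nonneg.2 h2)) (sub_nonneg.2 h3)
  have h5 : √3 ^ 2 = 3 := Real.sq_sqrt (by norm_num)
  have h6 := Real.sin_sq_add_cos_sq θ
  have h7 : (p - (-Real.cos θ + √3 * Real.sin θ)) * (p - 2 * Real.cos θ) *
      (p - (-Real.cos θ - √3 * Real.sin θ)) =
      p ^ 3 - 3 * p - 2 * (4 * Real.cos θ ^ 3 - 3 * Real.cos θ) := by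
    linear_combination (-(Real.sin θ ^ 2) * (p - 2 * Real.cos θ)) * h5
      - 3 * (p - 2 * Real.cos θ) * h6
  rw [Real.cos_three_mul]
  linarith

/-- The binary form controlling the principal `2 × 2` minors of the image of a rank one matrix. -/
lemma minor_nonneg {a b c : ℝ} (ha : 0 ≤ a) (hb : 0 ≤ b) (hc : 0 ≤ c)
    (h : a ≤ 1 → (1 - a) ^ 2 ≤ b * c) {x y : ℝ} (hx : 0 ≤ x) (hy : 0 ≤ y) :
    x * y ≤ (a * x + b * y) * (c * x + a * y) := by
  have hβ := Real.sq_sqrt hb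
  have hγ := Real.sq_sqrt hc
  have hβ0 := Real.sqrt_nonneg b
  have hγ0 := Real.sqrt_nonneg c
  have h1 : 1 ≤ a + √b * √c := by
    rcases le_total a 1 with h' | h'
    · have := h h'
      have : 1 - a ≤ √b * √c := by
        rw [← Real.sqrt_mul hb]
        exact Real.le_sqrt_of_sq_le this
      linarith
    · have := mul_nonneg hβ0 hγ0
      linarith
  have h2 : 0 ≤ ((a + √b * √c) ^ 2 - 1) * (x * y) :=
    mul_nonneg (by nlinarith) (mul_nonneg hx hy)
  have h3 := mul_nonneg ha (sq_nonneg (√c * x - √b * y))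
  have h4 : (a * x + b * y) * (c * x + a * y) - x * y =
      ((a + √b * √c) ^ 2 - 1) * (x * y) + a * (√c * x - √b * y) ^ 2 := by
    generalize √b = β at *
    generalize √c = γ at *
    subst hβ hγ
    ring
  linarith

lemma det_nonneg_of_le {a b c k : ℝ} (ha : 0 ≤ a) (hb : 0 ≤ b) (hc : 0 ≤ c)
    (hk : k ≤ (a + b + c) ^ 3 - 3 * (a + b + c))
    (h : a ≤ 1 → (1 - a) ^ 2 ≤ b * c) {x y z : ℝ} (hz : 0 ≤ z) (hx : z ≤ x) (hy : z ≤ y) :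
    0 ≤ (a * x + b * y + c * z) * (c * x + a * y + b * z) * (b * x + c * y + a * z)
      - (a * x + b * y + c * z) * (y * z) - (c * x + a * y + b * z) * (x * z)
      - (b * x + c * y + a * z) * (x * y) - k * (x * y * z) := by
  obtain ⟨u, rfl⟩ : ∃ u, x = z + u := ⟨x - z, by ring⟩
  obtain ⟨v, rfl⟩ : ∃ v, y = z + v := ⟨y - z, by ring⟩
  have hu : 0 ≤ u := by linarith
  have hv : 0 ≤ v := by linarith
  have h1 := mul_nonneg (sub_nonneg.2 hk) (by positivity : 0 ≤ (z + u) * (z + v) * z)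
  have h2 := mul_nonneg (by positivity : 0 ≤ b * u + c * v)
    (sub_nonneg.2 (minor_nonneg ha hb hc h hu hv))
  have h3 := mul_nonneg (by positivity : 0 ≤ b + c)
    (sub_nonneg.2 (minor_nonneg ha hb hc h zero_le_one zero_le_one))
  have h4 : 0 ≤ u ^ 2 - u * v + v ^ 2 := by nlinarith [sq_nonneg (u - v)]
  have h5 : 0 ≤ a * b * c + (b + c) * ((a * 1 + b * 1) * (c * 1 + a * 1) - 1 * 1) := by
    positivity
  have h6 := mul_nonneg (mul_nonneg hz h5) h4
  linarith

lemma phiHK_det_nonneg {a b c k : ℝ} (ha : 0 ≤ a) (hb : 0 ≤ b) (hc : 0 ≤ c)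
    (hk : k ≤ (a + b + c) ^ 3 - 3 * (a + b + c))
    (h : a ≤ 1 → (1 - a) ^ 2 ≤ b * c) {x y z : ℝ} (hx : 0 ≤ x) (hy : 0 ≤ y) (hz : 0 ≤ z) :
    0 ≤ (a * x + b * y + c * z) * (c * x + a * y + b * z) * (b * x + c * y + a * z)
      - (a * x + b * y + c * z) * (y * z) - (c * x + a * y + b * z) * (x * z)
      - (b * x + c * y + a * z) * (x * y) - k * (x * y * z) := by
  rcases le_total x y with hxy | hxy <;> rcases le_total y z with hyz | hyz <;>
    rcases le_total x z with hxz | hxz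
  all_goals first
    | exact det_nonneg_of_le ha hb hc hk h hz (by linarith) (by linarith)
    | linarith [det_nonneg_of_le ha hb hc hk h (x := y) (y := z) hx (by linarith) (by linarith)]
    | linarith [det_nonneg_of_le ha hb hc hk h (x := z) (y := x) hy (by linarith) (by linarith)]

lemma phiHK_vecMulVec_posSemidef {a b c θ : ℝ} (ha : 0 ≤ a) (hb : 0 ≤ b) (hc : 0 ≤ c)
    (hp : pTheta θ ≤ a + b + c) (h : a ≤ 1 → (1 - a) ^ 2 ≤ b * c) (v : Fin 3 → ℂ) :
    (phiHK a b c θ (vecMulVec (star v) v)).PosSemidef := by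
  set x := Complex.normSq (v 0) with hx
  set y := Complex.normSq (v 1) with hy
  set z := Complex.normSq (v 2) with hz
  have hx0 : 0 ≤ x := Complex.normSq_nonneg _
  have hy0 : 0 ≤ y := Complex.normSq_nonneg _
  have hz0 : 0 ≤ z := Complex.normSq_nonneg _
  have hexp : ∀ t : ℝ, Complex.normSq (Complex.exp (t * Complex.I)) = 1 := fun t => by
    rw [Complex.normSq_eq_norm_sq, Complex.norm_exp_ofReal_mul_I, one_pow]
  have hstar : star (Complex.exp (θ * Complex.I)) = Complex.exp (-θ * Complex.I) := by
    rw [Complex.star_def, ← Complex.exp_conj]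
    simp
  have hα : Complex.normSq (-Complex.exp (θ * Complex.I) * (star (v 0) * v 1)) = x * y := by
    simp [hexp, hx, hy, Complex.normSq_conj]
  have hβ : Complex.normSq (-Complex.exp (θ * Complex.I) * (star (v 1) * v 2)) = y * z := by
    simp [hexp, hy, hz, Complex.normSq_conj]
  have hγ : Complex.normSq (-Complex.exp (θ * Complex.I) * (star (v 2) * v 0)) = x * z := by
    simp [hexp, hx, hz, Complex.normSq_conj, mul_comm (Complex.normSq (v 2))]
  have hprod : (-Complex.exp (θ * Complex.I) * (star (v 0) * v 1) *
      (-Complex.exp (θ * Complex.I) * (star (v 1) * v 2)) *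
      (-Complex.exp (θ * Complex.I) * (star (v 2) * v 0))).re
      = -(Real.cos (3 * θ) * (x * y * z)) := by
    have h3 : Complex.exp (θ * Complex.I) ^ 3 = Complex.exp ((3 * θ : ℝ) * Complex.I) := by
      rw [← Complex.exp_nat_mul]
      push_cast
      ring_nf
    have : -Complex.exp (θ * Complex.I) * (star (v 0) * v 1) *
      (-Complex.exp (θ * Complex.I) * (star (v 1) * v 2)) *
      (-Complex.exp (θ * Complex.I) * (star (v 2) * v 0)) =
        -(Complex.exp ((3 * θ : ℝ) * Complex.I) * ((x * y * z : ℝ) : ℂ)) := by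
      rw [← h3]
      push_cast
      rw [hx, hy, hz, Complex.normSq_eq_conj_mul_self, Complex.normSq_eq_conj_mul_self,
        Complex.normSq_eq_conj_mul_self]
      simp only [Complex.star_def]
      ring
    rw [this, Complex.neg_re, Complex.re_mul_ofReal, Complex.exp_ofReal_mul_I_re]
  have hminor : ∀ {s t r : ℝ}, 0 ≤ s → 0 ≤ t → 0 ≤ r →
      s * t ≤ (a * s + b * t + c * r) * (c * s + a * t + b * r) := fun {s t r} hs ht hr => by
    refine (minor_nonneg ha hb hc h hs ht).trans ?_
    have : 0 ≤ c * r := by positivity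
    have : 0 ≤ b * r := by positivity
    exact mul_le_mul (by linarith) (by linarith) (by positivity) (by positivity)
  have key := posSemidef_fin_three (d₁ := a * x + b * y + c * z) (d₂ := c * x + a * y + b * z)
    (d₃ := b * x + c * y + a * z) (α := -Complex.exp (θ * Complex.I) * (star (v 0) * v 1))
    (β := -Complex.exp (θ * Complex.I) * (star (v 1) * v 2))
    (γ := -Complex.exp (θ * Complex.I) * (star (v 2) * v 0))
    (by positivity) (by positivity) (by positivity)
    (by rw [hα]; exact hminor hx0 hy0 hz0)
    (by rw [hβ]; linarith [hminor hy0 hz0 hx0])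
    (by rw [hγ]; linarith [hminor hz0 hx0 hy0])
    (by
      rw [hα, hβ, hγ, hprod]
      linarith [phiHK_det_nonneg ha hb hc (two_mul_cos_three_mul_le hp) h hx0 hy0 hz0])
  convert key using 1
  simp only [star_mul', star_neg, hstar, star_star]
  push_cast
  rw [hx, hy, hz, Complex.normSq_eq_conj_mul_self, Complex.normSq_eq_conj_mul_self,
    Complex.normSq_eq_conj_mul_self]
  ext i j
  fin_cases i <;> fin_cases j <;> simp [phiHK, vecMulVec_apply, mul_comm]

lemma phiHK_sum {ι : Type*} (s : Finset ι) (a b c θ : ℝ)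
    (f : ι → Matrix (Fin 3) (Fin 3) ℂ) :
    phiHK a b c θ (∑ k ∈ s, f k) = ∑ k ∈ s, phiHK a b c θ (f k) := by
  ext i j
  fin_cases i <;> fin_cases j <;>
    simp [phiHK, Matrix.sum_apply, Finset.mul_sum, Finset.sum_add_distrib]

open scoped MatrixOrder in
lemma phiHK_posSemidef {a b c θ : ℝ} (ha : 0 ≤ a) (hb : 0 ≤ b) (hc : 0 ≤ c)
    (hp : pTheta θ ≤ a + b + c) (h : a ≤ 1 → (1 - a) ^ 2 ≤ b * c)
    {x : Matrix (Fin 3) (Fin 3) ℂ} (hx : x.PosSemidef) : (phiHK a b c θ x).PosSemidef := by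
  obtain ⟨B, rfl⟩ := CStarAlgebra.nonneg_iff_eq_star_mul_self.mp hx.nonneg
  rw [star_eq_conjTranspose]
  have : Bᴴ * B = ∑ k, vecMulVec (star (B k)) (B k) := by
    ext i j
    simp [Matrix.mul_apply, Matrix.sum_apply, vecMulVec_apply]
  rw [this, phiHK_sum]
  exact posSemidef_sum _ fun k _ => phiHK_vecMulVec_posSemidef ha hb hc hp h (B k)

/-- Evaluating the image of a rank one matrix at a vector. -/
lemma re_phiHK_form_nonneg {a b c θ : ℝ}
    (H : ∀ x : Matrix (Fin 3) (Fin 3) ℂ, x.PosSemidef → (phiHK a b c θ x).PosSemidef)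
    (v w : Fin 3 → ℂ) :
    0 ≤ (star w ⬝ᵥ phiHK a b c θ (vecMulVec (star v) v) *ᵥ w).re :=
  (Complex.nonneg_iff.1 ((H _ (posSemidef_vecMulVec_star_self v)).dotProduct_mulVec_nonneg w)).1

lemma pTheta_le_of_positive {a b c θ : ℝ}
    (H : ∀ x : Matrix (Fin 3) (Fin 3) ℂ, x.PosSemidef → (phiHK a b c θ x).PosSemidef) :
    pTheta θ ≤ a + b + c := by
  have h3 : √3 ^ 2 = 3 := Real.sq_sqrt (by norm_num)
  have hω := fun ω : ℂ => re_phiHK_form_nonneg H (fun _ => 1) ![1, ω, star ω]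
  have h0 := hω 1
  have h1 := hω ⟨-1 / 2, √3 / 2⟩
  have h2 := hω ⟨-1 / 2, -(√3 / 2)⟩
  simp [phiHK, vecMulVec_apply, dotProduct, mulVec, Fin.sum_univ_three, Complex.exp_re,
    Complex.exp_im] at h0 h1 h2
  rw [pTheta_le_iff]
  refine ⟨⟨?_, ?_⟩, ?_⟩
  all_goals
    ring_nf at h0 h1 h2 ⊢
    simp only [h3] at h1 h2
    linarith

lemma sq_le_mul_of_positive {a b c θ : ℝ} (hb : 0 ≤ b) (hc : 0 ≤ c)
    (H : ∀ x : Matrix (Fin 3) (Fin 3) ℂ, x.PosSemidef → (phiHK a b c θ x).PosSemidef)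
    (ha : a ≤ 1) : (1 - a) ^ 2 ≤ b * c := by
  have hq : ∀ t : ℝ, 0 ≤ b * (t * t) + (-2 * (1 - a)) * t + c := by
    intro t
    rcases le_total t 0 with ht | ht
    · have : 0 ≤ (1 - a) * -t := mul_nonneg (by linarith) (by linarith)
      have : 0 ≤ b * (t * t) := mul_nonneg hb (mul_self_nonneg t)
      linarith
    · have h1 := re_phiHK_form_nonneg H ![1, (√t : ℝ), 0]
        ![(√t : ℝ), Complex.exp (-θ * Complex.I), 0]
      have h2 := Real.mul_self_sqrt ht
      have h3 := Real.sin_sq_add_cos_sq θ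
      simp [phiHK, vecMulVec_apply, dotProduct, mulVec, Fin.sum_univ_three, Complex.exp_re,
        Complex.exp_im] at h1
      generalize √t = s at *
      subst h2
      linear_combination h1 + (c + a * (s * s) - 2 * (s * s)) * h3
  have := discrim_le_zero hq
  unfold discrim at this
  linarith

theorem phiHK_positive_iff (a b c θ : ℝ)
    (ha : 0 ≤ a) (hb : 0 ≤ b) (hc : 0 ≤ c)
    (hθ₁ : -Real.pi ≤ θ) (hθ₂ : θ ≤ Real.pi) :
    (∀ x : Matrix (Fin 3) (Fin 3) ℂ, x.PosSemidef → (phiHK a b c θ x).PosSemidef) ↔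
      (pTheta θ ≤ a + b + c ∧ (a ≤ 1 → (1 - a) ^ 2 ≤ b * c)) := by
  refine ⟨fun H => ⟨pTheta_le_of_positive H, sq_le_mul_of_positive hb hc H⟩, fun h x hx => ?_⟩
  exact phiHK_posSemidef ha hb hc h.1 h.2 hx
end
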